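/- Fix λ > 0, set δ = (A(λ)/ζ(2))^{1/3} and z_n = 1 − δ·n^{−1/3} for n large. Then, as n → ∞, 𝒩(n, n, ⌊c(λ) n^{2/3}⌋) · z_n^{2n} · λ^{⌊c(λ) n^{2/3}⌋} · ∏_{x∈X} (1 − z_n^{x₁+x₂})/(1 + (λ−1)·z_n^{x₁+x₂}) = O(n^{−5/3}), where the (convergent) infinite product is taken over all x = (x₁,x₂) ∈ X. (This quantity is the probability Q_{z_n,z_n,λ}(Π(n,n,⌊c(λ)n^{2/3}⌋)) of the statistical-mechanical measure used in the proof of Theorem 1.) -/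

import Mathlib

open Real Filter Asymptotics MeasureTheory

/-- The set of pairs of coprime nonnegative integers (including `(0,1)` and `(1,0)`). -/
abbrev Xc : Type := {x : ℕ × ℕ // Nat.gcd x.1 x.2 = 1}

/-- The endpoint of the convex chain encoded by a finitely supported `ν : X →₀ ℕ`. -/
def chainEndpoint (ν : Xc →₀ ℕ) : ℕ × ℕ :=
  (ν.sum fun x m => m * x.val.1, ν.sum fun x m => m * x.val.2)

/-- `𝒩(n₁,n₂,N)`: the number of convex chains with endpoint `(n₁,n₂)` and `N` vertices. -/
noncomputable def numChains (n₁ n₂ N : ℕ) : ℕ :=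
  Nat.card {ν : Xc →₀ ℕ // chainEndpoint ν = (n₁, n₂) ∧ ν.support.card = N}

/-- `A(λ) = ζ(3) − Li₃(1−λ)` as an integral over the positive quadrant. -/
noncomputable def Aint (l : ℝ) : ℝ :=
  ∫ t : ℝ × ℝ in Set.Ioi (0:ℝ) ×ˢ Set.Ioi (0:ℝ),
    l * t.1 * Real.exp (-(t.1 + t.2)) /
      ((1 - Real.exp (-(t.1 + t.2))) * (1 + (l - 1) * Real.exp (-(t.1 + t.2))))

/-- `B(λ) = λ·Li₂(1−λ)/(1−λ)` as an integral over the positive quadrant. -/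
noncomputable def Bint (l : ℝ) : ℝ :=
  ∫ t : ℝ × ℝ in Set.Ioi (0:ℝ) ×ˢ Set.Ioi (0:ℝ),
    l * Real.exp (-(t.1 + t.2)) / (1 + (l - 1) * Real.exp (-(t.1 + t.2)))

noncomputable def zeta2 : ℝ := π ^ 2 / 6

noncomputable def cfun (l : ℝ) : ℝ := Bint l / (zeta2 ^ ((1:ℝ)/3) * Aint l ^ ((2:ℝ)/3))

/-- `δ = (A(λ)/ζ(2))^{1/3}`. -/
noncomputable def deltafun (l : ℝ) : ℝ := (Aint l / zeta2) ^ ((1:ℝ)/3)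

/-- `z_n = 1 − δ·n^{−1/3}`. -/
noncomputable def zseq (l : ℝ) (n : ℕ) : ℝ := 1 - deltafun l * (n : ℝ) ^ (-(1:ℝ)/3)

/-- The single-edge weight `q_x(k)` for an edge direction with `x₁ + x₂ = m`. -/
noncomputable def edgeWeight (z l : ℝ) (m k : ℕ) : ℝ :=
  (1 - z ^ m) / (1 + (l - 1) * z ^ m) * if k = 0 then 1 else l * z ^ (m * k)

/-- The phase of `k` copies of the edge `x` at the frequencies `t`. -/
noncomputable def edgePhase (x : ℕ × ℕ) (t : ℝ × ℝ × ℝ) (k : ℕ) : ℝ :=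
  k * (t.1 * x.1 + t.2.1 * x.2) + if k = 0 then 0 else t.2.2

/-- The characteristic function of a single edge truncated to multiplicities at most `n`. -/
noncomputable def edgeChar (z l : ℝ) (n : ℕ) (x : ℕ × ℕ) (t : ℝ × ℝ × ℝ) : ℂ :=
  ∑ k ∈ Finset.range (n + 1),
    (edgeWeight z l (x.1 + x.2) k : ℂ) * Complex.exp (edgePhase x t k * Complex.I)

lemma one_add_sub_one_mul_pos {l w : ℝ} (hl : 0 < l) (h0 : 0 ≤ w) (h1 : w < 1) :
    0 < 1 + (l - 1) * w := by
  nlinarith [mul_nonneg hl.le h0]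

lemma edgeWeight_nonneg {z l : ℝ} (hl : 0 < l) (hz0 : 0 < z) (hz1 : z < 1) {m : ℕ} (hm : m ≠ 0)
    (k : ℕ) : 0 ≤ edgeWeight z l m k := by
  have h1 := pow_lt_one₀ hz0.le hz1 hm
  have h2 := one_add_sub_one_mul_pos hl (pow_pos hz0 m).le h1
  unfold edgeWeight
  have h3 : 0 ≤ 1 - z ^ m := by linarith
  split_ifs <;> positivity

lemma sum_edgeWeight_le_one {z l : ℝ} (hl : 0 < l) (hz0 : 0 < z) (hz1 : z < 1) {m : ℕ}
    (hm : m ≠ 0) (n : ℕ) : ∑ k ∈ Finset.range (n + 1), edgeWeight z l m k ≤ 1 := by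
  have h1 := pow_lt_one₀ hz0.le hz1 hm
  have hw := pow_pos hz0 m
  have h2 := one_add_sub_one_mul_pos hl hw.le h1
  rw [Finset.sum_range_succ']
  simp only [edgeWeight, Nat.add_eq_zero_iff, one_ne_zero, and_false, if_false, if_true, mul_one,
    ← Finset.mul_sum, pow_mul]
  set w := z ^ m
  have h3 : ∑ k ∈ Finset.range n, w ^ (k + 1) ≤ w / (1 - w) := by
    have := geom_sum_eq h1.ne n
    simp only [pow_succ, ← Finset.sum_mul]
    rw [this, ← neg_div_neg_eq, neg_sub, neg_sub, div_mul_eq_mul_div]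
    have := pow_pos hw n
    gcongr
    · nlinarith
  have h4 : 0 < 1 - w := by linarith
  calc (1 - w) / (1 + (l - 1) * w) * (l * ∑ k ∈ Finset.range n, w ^ (k + 1))
        + (1 - w) / (1 + (l - 1) * w)
      ≤ (1 - w) / (1 + (l - 1) * w) * (l * (w / (1 - w))) + (1 - w) / (1 + (l - 1) * w) := by
        gcongr
    _ = 1 := by
        rw [div_mul_eq_mul_div, ← add_div, div_eq_one_iff_eq h2.ne']
        field_simp
        ring

lemma norm_two_phases_le {p q a b : ℝ} (hp : 0 ≤ p) (hq : 0 ≤ q) (hpq : p + q ≤ 1) :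
    ‖(p : ℂ) * Complex.exp (a * Complex.I) + q * Complex.exp (b * Complex.I)‖ ≤
      p + q - p * q * (1 - cos (a - b)) := by
  have h0 : 0 ≤ 1 - cos (a - b) := by linarith [cos_le_one (a - b)]
  have h2 : 1 - cos (a - b) ≤ 2 := by linarith [neg_one_le_cos (a - b)]
  have hpq0 := mul_nonneg hp hq
  have hnn : 0 ≤ p + q - p * q * (1 - cos (a - b)) := by nlinarith
  refine abs_le_of_sq_le_sq' ?_ hnn |>.2
  rw [← Complex.normSq_eq_norm_sq, Complex.normSq_apply]
  simp only [Complex.add_re, Complex.add_im, Complex.re_ofReal_mul, Complex.im_ofReal_mul,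
    Complex.exp_ofReal_mul_I_re, Complex.exp_ofReal_mul_I_im]
  have e : (p * cos a + q * cos b) * (p * cos a + q * cos b)
      + (p * sin a + q * sin b) * (p * sin a + q * sin b)
      = (p + q) ^ 2 - 2 * (p * q) * (1 - cos (a - b)) := by
    rw [cos_sub]
    linear_combination p ^ 2 * sin_sq_add_cos_sq a + q ^ 2 * sin_sq_add_cos_sq b
  rw [e]
  nlinarith [mul_nonneg hpq0 h0, mul_nonneg (mul_nonneg hpq0 h0) (sub_nonneg.mpr hpq),
    sq_nonneg (p * q * (1 - cos (a - b)))]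

lemma norm_edgeChar_le_one {z l : ℝ} (hl : 0 < l) (hz0 : 0 < z) (hz1 : z < 1) (n : ℕ)
    {x : ℕ × ℕ} (hx : x.1 + x.2 ≠ 0) (t : ℝ × ℝ × ℝ) : ‖edgeChar z l n x t‖ ≤ 1 := by
  refine (norm_sum_le _ _).trans (le_trans (le_of_eq ?_) (sum_edgeWeight_le_one hl hz0 hz1 hx n))
  refine Finset.sum_congr rfl fun k _ => ?_
  rw [norm_mul, Complex.norm_exp_ofReal_mul_I, mul_one, Complex.norm_real,
    norm_of_nonneg (edgeWeight_nonneg hl hz0 hz1 hx k)]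

lemma norm_edgeChar_le_exp {z l : ℝ} (hl : 0 < l) (hz0 : 0 < z) (hz1 : z < 1) {n : ℕ}
    (hn : 2 ≤ n) {x : ℕ × ℕ} (hx : x.1 + x.2 ≠ 0) {c : ℝ}
    (hc1 : 2 * c ≤ edgeWeight z l (x.1 + x.2) 0 * edgeWeight z l (x.1 + x.2) 1)
    (hc2 : 2 * c ≤ edgeWeight z l (x.1 + x.2) 1 * edgeWeight z l (x.1 + x.2) 2)
    (t : ℝ × ℝ × ℝ) :
    ‖edgeChar z l n x t‖ ≤ exp (-(c * ((1 - cos (t.1 * x.1 + t.2.1 * x.2 + t.2.2))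
      + (1 - cos (t.1 * x.1 + t.2.1 * x.2))))) := by
  have hnn := edgeWeight_nonneg hl hz0 hz1 hx
  have hsum := sum_edgeWeight_le_one hl hz0 hz1 hx n
  obtain ⟨j, rfl⟩ : ∃ j, n = j + 2 := ⟨n - 2, by omega⟩
  set q := edgeWeight z l (x.1 + x.2) with hq
  set a := t.1 * x.1 + t.2.1 * x.2 with ha
  have h0 : 0 ≤ 1 - cos (a + t.2.2) := by linarith [cos_le_one (a + t.2.2)]
  have h1 : 0 ≤ 1 - cos a := by linarith [cos_le_one a]
  rw [Finset.sum_range_succ', Finset.sum_range_succ', Finset.sum_range_succ'] at hsum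
  have hrest : ‖∑ k ∈ Finset.range j, (q (k + 1 + 1 + 1) : ℂ) *
      Complex.exp (edgePhase x t (k + 1 + 1 + 1) * Complex.I)‖ ≤
      ∑ k ∈ Finset.range j, q (k + 1 + 1 + 1) := by
    refine (norm_sum_le _ _).trans (le_of_eq (Finset.sum_congr rfl fun k _ => ?_))
    rw [norm_mul, Complex.norm_exp_ofReal_mul_I, mul_one, Complex.norm_real, norm_of_nonneg (hnn _)]
  have hrest0 : 0 ≤ ∑ k ∈ Finset.range j, q (k + 1 + 1 + 1) := Finset.sum_nonneg fun k _ => hnn _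
  simp only [zero_add] at hsum
  norm_num only at hsum
  have b1 := norm_two_phases_le (p := q 0) (q := q 1 / 2) (a := edgePhase x t 0)
    (b := edgePhase x t 1) (hnn 0) (by linarith [hnn 1]) (by linarith [hnn 1, hnn 2])
  have b2 := norm_two_phases_le (p := q 1 / 2) (q := q 2) (a := edgePhase x t 1)
    (b := edgePhase x t 2) (by linarith [hnn 1]) (hnn 2) (by linarith [hnn 1, hnn 0])
  have p1 : cos (edgePhase x t 0 - edgePhase x t 1) = cos (a + t.2.2) := by
    rw [← cos_neg]; congr 1; simp [edgePhase, ha]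
  have p2 : cos (edgePhase x t 1 - edgePhase x t 2) = cos a := by
    rw [← cos_neg]; congr 1; simp [edgePhase, ha]; ring
  rw [p1] at b1
  rw [p2] at b2
  have hsplit : edgeChar z l (j + 2) x t =
      (∑ k ∈ Finset.range j, (q (k + 1 + 1 + 1) : ℂ) *
        Complex.exp (edgePhase x t (k + 1 + 1 + 1) * Complex.I)) +
      (((q 0 : ℝ) : ℂ) * Complex.exp (edgePhase x t 0 * Complex.I) +
        ((q 1 / 2 : ℝ) : ℂ) * Complex.exp (edgePhase x t 1 * Complex.I)) +
      (((q 1 / 2 : ℝ) : ℂ) * Complex.exp (edgePhase x t 1 * Complex.I) +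
        ((q 2 : ℝ) : ℂ) * Complex.exp (edgePhase x t 2 * Complex.I)) := by
    rw [edgeChar, Finset.sum_range_succ', Finset.sum_range_succ', Finset.sum_range_succ', ← hq]
    simp only [zero_add, one_add_one_eq_two]
    push_cast
    ring
  have hfin : ‖edgeChar z l (j + 2) x t‖ ≤
      1 - (c * ((1 - cos (a + t.2.2)) + (1 - cos a))) := by
    rw [hsplit]
    refine (norm_add₃_le).trans ?_
    nlinarith [mul_le_mul_of_nonneg_right hc1 h0, mul_le_mul_of_nonneg_right hc2 h1]
  refine hfin.trans ?_
  linarith [add_one_le_exp (-(c * ((1 - cos (a + t.2.2)) + (1 - cos a))))]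

lemma sum_inv_sq_le (R : ℕ) (hR : 2 ≤ R) :
    ∑ d ∈ Finset.Icc 2 R, (1 / (d : ℝ) ^ 2) ≤ 3 / 4 - 1 / (R : ℝ) := by
  induction R, hR using Nat.le_induction with
  | base => norm_num
  | succ n hn ih =>
    rw [Finset.sum_Icc_succ_top (by omega)]
    have hn' : (2 : ℝ) ≤ n := by exact_mod_cast hn
    have : 1 / ((n : ℝ) + 1) ^ 2 ≤ 1 / n - 1 / (n + 1) := by
      rw [div_sub_div _ _ (by positivity) (by positivity), div_le_div_iff₀ (by positivity) (by positivity)]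
      nlinarith
    push_cast
    linarith

/-- At least a quarter of the points of the square `[1, R]²` are primitive. -/
lemma card_coprime_square (R : ℕ) (hR : 2 ≤ R) :
    (R : ℝ) ^ 2 / 4 ≤
      (((Finset.Ioc 0 R ×ˢ Finset.Ioc 0 R).filter fun x => Nat.gcd x.1 x.2 = 1).card : ℝ) := by
  set B := Finset.Ioc 0 R ×ˢ Finset.Ioc 0 R with hB
  have hsub : (B.filter fun x => ¬ Nat.gcd x.1 x.2 = 1) ⊆
      (Finset.Icc 2 R).biUnion fun d =>
        ((Finset.Ioc 0 R).filter (d ∣ ·)) ×ˢ ((Finset.Ioc 0 R).filter (d ∣ ·)) := by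
    rintro ⟨a, b⟩ h
    simp only [hB, Finset.mem_filter, Finset.mem_product, Finset.mem_Ioc, Finset.mem_biUnion,
      Finset.mem_Icc] at h ⊢
    refine ⟨Nat.gcd a b, ⟨?_, ?_⟩, ⟨h.1.1, Nat.gcd_dvd_left a b⟩, h.1.2, Nat.gcd_dvd_right a b⟩
    · have : 0 < Nat.gcd a b := Nat.gcd_pos_of_pos_left _ h.1.1.1
      omega
    · exact (Nat.gcd_le_left b h.1.1.1).trans h.1.1.2
  have hcard : ((B.filter fun x => ¬ Nat.gcd x.1 x.2 = 1).card : ℝ) ≤ 3 / 4 * (R : ℝ) ^ 2 := by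
    calc ((B.filter fun x => ¬ Nat.gcd x.1 x.2 = 1).card : ℝ)
        ≤ ∑ d ∈ Finset.Icc 2 R, ((R / d * (R / d) : ℕ) : ℝ) := by
          have h1 := (Finset.card_le_card hsub).trans Finset.card_biUnion_le
          simp only [Finset.card_product, Nat.Ioc_filter_dvd_card_eq_div] at h1
          exact_mod_cast h1
      _ ≤ ∑ d ∈ Finset.Icc 2 R, (R : ℝ) ^ 2 * (1 / (d : ℝ) ^ 2) := by
          refine Finset.sum_le_sum fun d _ => ?_
          have h2 : ((R / d : ℕ) : ℝ) ≤ R / d := Nat.cast_div_le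
          push_cast
          calc ((R / d : ℕ) : ℝ) * ((R / d : ℕ) : ℝ) ≤ ((R : ℝ) / d) * (R / d) := by gcongr
            _ = _ := by ring
      _ ≤ (R : ℝ) ^ 2 * (3 / 4) := by
          rw [← Finset.mul_sum]
          have := sum_inv_sq_le R hR
          have h3 : (0 : ℝ) ≤ 1 / R := by positivity
          gcongr
          linarith
      _ = _ := by ring
  have htot : ((B.filter fun x => Nat.gcd x.1 x.2 = 1).card : ℝ) +
      ((B.filter fun x => ¬ Nat.gcd x.1 x.2 = 1).card : ℝ) = (R : ℝ) ^ 2 := by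
    have := Finset.card_filter_add_card_filter_not (s := B) (fun x => Nat.gcd x.1 x.2 = 1)
    rw [hB] at this ⊢
    rw [Finset.card_product, Nat.card_Ioc] at this
    rw [sq]
    exact_mod_cast this
  linarith

lemma card_filter_abs_sub_le (s : Finset ℕ) (t ρ : ℝ) (hρ : 0 ≤ ρ) :
    ((s.filter fun k : ℕ => |(k : ℝ) - t| ≤ ρ).card : ℝ) ≤ 2 * ρ + 1 := by
  have h : (s.filter fun k : ℕ => |(k : ℝ) - t| ≤ ρ).card ≤ (Finset.Icc ⌈t - ρ⌉ ⌊t + ρ⌋).card := by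
    refine Finset.card_le_card_of_injOn (fun k => (k : ℤ)) ?_ (fun a _ b _ h => by simpa using h)
    intro k hk
    simp only [Finset.coe_filter, Set.mem_ofPred_eq, abs_le] at hk
    simp only [Finset.coe_Icc, Set.mem_Icc, Int.ceil_le, Int.le_floor, Int.cast_natCast]
    constructor <;> linarith [hk.2.1, hk.2.2]
  rw [Int.card_Icc] at h
  have h2 : (((⌊t + ρ⌋ + 1 - ⌈t - ρ⌉).toNat : ℕ) : ℝ) ≤ 2 * ρ + 1 := by
    rcases le_total (⌊t + ρ⌋ + 1 - ⌈t - ρ⌉) 0 with h0 | h0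
    · rw [Int.toNat_of_nonpos h0]; push_cast; linarith
    · have : (((⌊t + ρ⌋ + 1 - ⌈t - ρ⌉).toNat : ℤ) : ℝ) = ((⌊t + ρ⌋ + 1 - ⌈t - ρ⌉ : ℤ) : ℝ) := by
        rw [Int.toNat_of_nonneg h0]
      rw [Int.cast_natCast] at this
      rw [this]; push_cast
      linarith [Int.floor_le (t + ρ), Int.le_ceil (t - ρ)]
  exact (Nat.cast_le.mpr h).trans h2

lemma card_strip_le (R : ℕ) (a b : ℝ) (ha : a ≠ 0) (η : ℝ) (hη : 0 ≤ η) :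
    (((Finset.Ioc 0 R ×ˢ Finset.Ioc 0 R).filter
      fun x => |a * x.1 + b * x.2| ≤ |a| * η).card : ℝ) ≤ R * (2 * η + 1) := by
  have h : ((Finset.Ioc 0 R ×ˢ Finset.Ioc 0 R).filter fun x => |a * x.1 + b * x.2| ≤ |a| * η).card
      ≤ ∑ y ∈ Finset.Ioc 0 R, ((Finset.Ioc 0 R).filter
          fun k : ℕ => |(k : ℝ) - (-(b / a * y))| ≤ η).card := by
    rw [Finset.card_filter, Finset.sum_product_right]
    refine Finset.sum_le_sum fun y _ => ?_
    rw [← Finset.card_filter]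
    refine Finset.card_le_card fun k hk => ?_
    rw [Finset.mem_filter] at hk ⊢
    refine ⟨hk.1, ?_⟩
    have h2 : a * (k : ℝ) + b * y = a * ((k : ℝ) - (-(b / a * y))) := by field_simp; ring
    have h3 := hk.2
    simp only at h3
    rw [h2, abs_mul] at h3
    exact le_of_mul_le_mul_left h3 (abs_pos.mpr ha)
  calc _ ≤ ((∑ y ∈ Finset.Ioc 0 R, ((Finset.Ioc 0 R).filter
          fun k : ℕ => |(k : ℝ) - (-(b / a * y))| ≤ η).card : ℕ) : ℝ) := Nat.cast_le.mpr h
    _ ≤ ∑ y ∈ Finset.Ioc 0 R, (2 * η + 1) := by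
        rw [Nat.cast_sum]
        exact Finset.sum_le_sum fun y _ => card_filter_abs_sub_le _ _ _ hη
    _ = _ := by simp [mul_add]

lemma card_strip_max_le (R : ℕ) (a b r : ℝ) (hr : 0 < r) (h : |a| = r ∨ |b| = r)
    (η : ℝ) (hη : 0 ≤ η) :
    (((Finset.Ioc 0 R ×ˢ Finset.Ioc 0 R).filter
      fun x => |a * x.1 + b * x.2| ≤ r * η).card : ℝ) ≤ R * (2 * η + 1) := by
  rcases h with rfl | rfl
  · exact card_strip_le R a b (abs_pos.mp hr) η hη
  · refine le_trans (le_of_eq ?_) (card_strip_le R b a (abs_pos.mp hr) η hη)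
    norm_cast
    refine Finset.card_bij (fun x _ => x.swap) ?_ ?_ ?_
    · rintro ⟨x, y⟩ hx
      simp only [Finset.mem_filter, Finset.mem_product, Prod.swap] at hx ⊢
      exact ⟨hx.1.symm, by rw [add_comm]; exact hx.2⟩
    · rintro x _ y _ h; exact Prod.swap_injective h
    · rintro ⟨x, y⟩ hx
      simp only [Finset.mem_filter, Finset.mem_product] at hx
      refine ⟨(y, x), ?_, rfl⟩
      simp only [Finset.mem_filter, Finset.mem_product]
      exact ⟨hx.1.symm, by rw [add_comm]; exact hx.2⟩

/-- Primitive vectors of size comparable to `R`. -/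
def primitiveShell (R : ℕ) : Finset (ℕ × ℕ) :=
  (Finset.range (4 * R + 1) ×ˢ Finset.range (4 * R + 1)).filter fun x =>
    Nat.gcd x.1 x.2 = 1 ∧ R ≤ 32 * (x.1 + x.2) ∧ x.1 + x.2 ≤ 4 * R

/-- The primitive vectors of size comparable to `R` off a strip of relative width `1 / 32`. -/
lemma card_primitiveShell_off_strip (R : ℕ) (hR : 16 ≤ R) (a b r : ℝ) (hr : 0 < r)
    (h : |a| = r ∨ |b| = r) :
    (R : ℝ) ^ 2 / 16 ≤ (((primitiveShell R).filter fun x =>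
      x.1 ≤ R ∧ x.2 ≤ R ∧ r * (R / 32) < |a * x.1 + b * x.2|).card : ℝ) := by
  set B := Finset.Ioc 0 R ×ˢ Finset.Ioc 0 R with hB
  have hR' : (16 : ℝ) ≤ R := by exact_mod_cast hR
  have hsub : (B.filter fun x => Nat.gcd x.1 x.2 = 1) ⊆
      ((primitiveShell R).filter fun x =>
        x.1 ≤ R ∧ x.2 ≤ R ∧ r * (R / 32) < |a * x.1 + b * x.2|) ∪
      ((B.filter fun x => |a * x.1 + b * x.2| ≤ r * (R / 32)) ∪
       (B.filter fun x => 32 * x.1 < R)) := by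
    rintro ⟨x, y⟩ hx
    simp only [hB, primitiveShell, Finset.mem_union, Finset.mem_filter, Finset.mem_product,
      Finset.mem_Ioc, Finset.mem_range] at hx ⊢
    rcases le_or_gt (|a * x + b * y|) (r * (R / 32)) with h1 | h1
    · exact Or.inr (Or.inl ⟨hx.1, h1⟩)
    · rcases lt_or_ge (32 * x) R with h2 | h2
      · exact Or.inr (Or.inr ⟨hx.1, h2⟩)
      · exact Or.inl ⟨⟨⟨by omega, by omega⟩, hx.2, by omega, by omega⟩, by omega, by omega, h1⟩
  have hsmall : ((B.filter fun x => 32 * x.1 < R).card : ℝ) ≤ R / 32 * R := by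
    have h1 : (B.filter fun x => 32 * x.1 < R) ⊆ Finset.Ioc 0 (R / 32) ×ˢ Finset.Ioc 0 R := by
      rintro ⟨x, y⟩ hx
      simp only [hB, Finset.mem_filter, Finset.mem_product, Finset.mem_Ioc] at hx ⊢
      omega
    have h2 := Finset.card_le_card h1
    rw [Finset.card_product, Nat.card_Ioc, Nat.card_Ioc] at h2
    calc _ ≤ (((R / 32 - 0) * (R - 0) : ℕ) : ℝ) := Nat.cast_le.mpr h2
      _ = ((R / 32 : ℕ) : ℝ) * R := by push_cast [Nat.sub_zero]; ring
      _ ≤ _ := by gcongr; exact Nat.cast_div_le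
  have h1 := card_coprime_square R (by omega)
  have h2 := card_strip_max_le R a b r hr h (R / 32) (by positivity)
  have h3 := (Finset.card_le_card hsub).trans ((Finset.card_union_le _ _).trans
    (Nat.add_le_add_left (Finset.card_union_le _ _) _))
  have h4 := (Nat.cast_le (α := ℝ)).mpr h3
  push_cast at h4
  nlinarith

lemma card_primitiveShell (R : ℕ) (hR : 16 ≤ R) :
    (R : ℝ) ^ 2 / 16 ≤ ((primitiveShell R).card : ℝ) :=
  (card_primitiveShell_off_strip R hR 1 0 1 one_pos (Or.inl abs_one)).trans
    (Nat.cast_le.mpr (Finset.card_filter_le _ _))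

lemma sq_div_five_le_one_sub_cos {t : ℝ} (ht : |t| ≤ π) : t ^ 2 / 5 ≤ 1 - cos t := by
  have h := cos_le_one_sub_mul_cos_sq ht
  have h2 : (1 : ℝ) / 5 ≤ 2 / π ^ 2 := by
    rw [div_le_div_iff₀ (by norm_num) (by positivity)]
    nlinarith [pi_lt_d2, pi_pos]
  nlinarith [sq_nonneg t]

lemma one_sub_cos_sub_le (a b : ℝ) : 1 - cos (a - b) ≤ 2 * ((1 - cos a) + (1 - cos b)) := by
  rw [cos_sub]
  nlinarith [sq_nonneg (cos a + cos b - 2), sq_nonneg (sin a + sin b), sin_sq_add_cos_sq a,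
    sin_sq_add_cos_sq b, cos_le_one a, cos_le_one b, sq_nonneg (cos a - cos b),
    sq_nonneg (sin a - sin b)]

lemma near_le_sum_one_sub_cos (R : ℕ) (hR : 16 ≤ R) (a b : ℝ) (ha : |a| * R ≤ 1)
    (hb : |b| * R ≤ 1) :
    (R : ℝ) ^ 4 * (a ^ 2 + b ^ 2) / 163840 ≤
      ∑ x ∈ primitiveShell R, (1 - cos (a * x.1 + b * x.2)) := by
  have hR' : (16 : ℝ) ≤ R := by exact_mod_cast hR
  set r := max |a| |b| with hr
  have hnn : ∀ x ∈ primitiveShell R, 0 ≤ 1 - cos (a * x.1 + b * x.2) :=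
    fun x _ => by linarith [cos_le_one (a * x.1 + b * x.2)]
  have hab : a ^ 2 + b ^ 2 ≤ 2 * r ^ 2 := by
    have h1 : |a| ≤ r := le_max_left _ _
    have h2 : |b| ≤ r := le_max_right _ _
    rw [← sq_abs a, ← sq_abs b]
    nlinarith [abs_nonneg a, abs_nonneg b]
  rcases (le_max_of_le_left (abs_nonneg a) : 0 ≤ r).eq_or_lt with h0 | h0
  · rw [hr, ← h0] at hab
    have : a ^ 2 + b ^ 2 = 0 := le_antisymm (by linarith) (by positivity)
    rw [this]; simpa using Finset.sum_nonneg hnn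
  have hcard := card_primitiveShell_off_strip R hR a b r h0
    ((max_choice |a| |b|).imp (fun h => by rw [hr, h]) (fun h => by rw [hr, h]))
  set G := (primitiveShell R).filter fun x =>
      x.1 ≤ R ∧ x.2 ≤ R ∧ r * (R / 32) < |a * x.1 + b * x.2| with hG
  calc (R : ℝ) ^ 4 * (a ^ 2 + b ^ 2) / 163840
      ≤ (R : ℝ) ^ 4 * (2 * r ^ 2) / 163840 := by gcongr
    _ = (R : ℝ) ^ 2 / 16 * ((r * (R / 32)) ^ 2 / 5) := by ring
    _ ≤ G.card * ((r * (R / 32)) ^ 2 / 5) := by gcongr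
    _ = ∑ x ∈ G, ((r * (R / 32)) ^ 2 / 5) := by simp
    _ ≤ ∑ x ∈ G, (1 - cos (a * x.1 + b * x.2)) := by
        refine Finset.sum_le_sum fun x hx => ?_
        rw [hG, Finset.mem_filter] at hx
        have hx1 : (x.1 : ℝ) ≤ R := by exact_mod_cast hx.2.1
        have hx2 : (x.2 : ℝ) ≤ R := by exact_mod_cast hx.2.2.1
        have hle : |a * x.1 + b * x.2| ≤ π := by
          calc |a * x.1 + b * x.2| ≤ |a * x.1| + |b * x.2| := abs_add_le _ _
            _ = |a| * x.1 + |b| * x.2 := by rw [abs_mul, abs_mul, Nat.abs_cast, Nat.abs_cast]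
            _ ≤ |a| * R + |b| * R := by gcongr
            _ ≤ π := by linarith [pi_gt_three]
        refine le_trans ?_ (sq_div_five_le_one_sub_cos hle)
        rw [← sq_abs (a * x.1 + b * x.2)]
        have := hx.2.2.2.le
        gcongr
    _ ≤ _ := Finset.sum_le_sum_of_subset_of_nonneg (Finset.filter_subset _ _)
        fun x hx _ => hnn x hx

/-- A progression of step `a` cannot stay close to `2πℤ` for longer than `3 / |a|` steps. -/
lemma progression_le_sum_one_sub_cos (R : ℕ) (a b : ℝ) (ha : 1 ≤ |a| * R) (hπ : |a| ≤ π) :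
    (R : ℝ) / 20 ≤ ∑ k ∈ Finset.Ico R (3 * R), (1 - cos (a * k + b)) := by
  have ha0 : 0 < |a| := by
    rcases (abs_nonneg a).eq_or_lt with h | h
    · rw [← h] at ha; norm_num at ha
    · exact h
  have hnn : ∀ k : ℕ, 0 ≤ 1 - cos (a * k + b) := fun k => by linarith [cos_le_one (a * k + b)]
  set d := ⌈1 / |a|⌉₊ with hd
  have hdR : d ≤ R := Nat.ceil_le.mpr (by rw [div_le_iff₀ ha0]; linarith)
  have hd1 : 1 ≤ |a| * d := by
    have := Nat.le_ceil (1 / |a|)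
    rw [div_le_iff₀ ha0] at this
    linarith
  have hd2 : |a| * d ≤ π := by
    rcases le_total |a| 1 with h | h
    · have := (Nat.ceil_lt_add_one (one_div_pos.mpr ha0).le).le
      calc |a| * d ≤ |a| * (1 / |a| + 1) := by gcongr
        _ = 1 + |a| := by field_simp
        _ ≤ π := by linarith [pi_gt_three]
    · have : d = 1 := by
        apply le_antisymm
        · exact Nat.ceil_le.mpr (by rw [div_le_iff₀ ha0]; simpa using h)
        · exact Nat.one_le_ceil_iff.mpr (one_div_pos.mpr ha0)
      rw [this]; simpa using hπ
  have hkey : ∀ k ∈ Finset.Ico R (2 * R), (1 : ℝ) / 10 ≤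
      (1 - cos (a * ((k + d : ℕ) : ℝ) + b)) + (1 - cos (a * k + b)) := by
    intro k _
    have h1 := one_sub_cos_sub_le (a * ((k + d : ℕ) : ℝ) + b) (a * k + b)
    have h2 : a * ((k + d : ℕ) : ℝ) + b - (a * k + b) = a * d := by push_cast; ring
    have habs : |a * d| = |a| * d := by rw [abs_mul, Nat.abs_cast]
    have h3 := sq_div_five_le_one_sub_cos (habs.trans_le hd2)
    rw [h2] at h1
    rw [← sq_abs, habs] at h3
    nlinarith
  have hsum := Finset.sum_le_sum hkey
  rw [Finset.sum_add_distrib] at hsum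
  have e1 : ∑ k ∈ Finset.Ico R (2 * R), (1 - cos (a * ((k + d : ℕ) : ℝ) + b)) ≤
      ∑ k ∈ Finset.Ico R (3 * R), (1 - cos (a * k + b)) := by
    rw [Finset.sum_Ico_add' (fun k : ℕ => 1 - cos (a * k + b))]
    exact Finset.sum_le_sum_of_subset_of_nonneg
      (Finset.Ico_subset_Ico (by omega) (by omega)) fun k _ _ => hnn k
  have e2 : ∑ k ∈ Finset.Ico R (2 * R), (1 - cos (a * k + b)) ≤
      ∑ k ∈ Finset.Ico R (3 * R), (1 - cos (a * k + b)) :=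
    Finset.sum_le_sum_of_subset_of_nonneg
      (Finset.Ico_subset_Ico le_rfl (by omega)) fun k _ _ => hnn k
  have e3 : ∑ k ∈ Finset.Ico R (2 * R), (1 : ℝ) / 10 = R / 10 := by
    rw [Finset.sum_const, Nat.card_Ico, show 2 * R - R = R by omega, nsmul_eq_mul]; ring
  linarith

lemma far_le_sum_one_sub_cos (R : ℕ) (hR : 16 ≤ R) (a b : ℝ) (ha : |a| ≤ π) (hb : |b| ≤ π)
    (h : 1 ≤ |a| * R ∨ 1 ≤ |b| * R) :
    (R : ℝ) / 20 ≤ ∑ x ∈ primitiveShell R, (1 - cos (a * x.1 + b * x.2)) := by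
  have hnn : ∀ x : ℕ × ℕ, 0 ≤ 1 - cos (a * x.1 + b * x.2) :=
    fun x => by linarith [cos_le_one (a * x.1 + b * x.2)]
  rcases h with h | h
  · refine (progression_le_sum_one_sub_cos R a b h ha).trans ?_
    calc _ = ∑ x ∈ (Finset.Ico R (3 * R)).image fun k : ℕ => ((k, 1) : ℕ × ℕ),
          (1 - cos (a * (x.1 : ℝ) + b * (x.2 : ℝ))) := by
          rw [Finset.sum_image (fun x _ y _ h => (Prod.mk.inj h).1)]; simp
      _ ≤ _ := by
          refine Finset.sum_le_sum_of_subset_of_nonneg ?_ fun x _ _ => hnn x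
          rintro ⟨x, y⟩ hx
          simp only [Finset.mem_image, Finset.mem_Ico, Prod.mk.injEq] at hx
          obtain ⟨k, hk, rfl, rfl⟩ := hx
          simp only [primitiveShell, Finset.mem_filter, Finset.mem_product, Finset.mem_range,
            Nat.gcd_one_right, true_and]
          omega
  · refine (progression_le_sum_one_sub_cos R b a h hb).trans ?_
    calc _ = ∑ x ∈ (Finset.Ico R (3 * R)).image fun k : ℕ => ((1, k) : ℕ × ℕ),
          (1 - cos (a * (x.1 : ℝ) + b * (x.2 : ℝ))) := by
          rw [Finset.sum_image (fun x _ y _ h => (Prod.mk.inj h).2)]; simp [add_comm]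
      _ ≤ _ := by
          refine Finset.sum_le_sum_of_subset_of_nonneg ?_ fun x _ _ => hnn x
          rintro ⟨x, y⟩ hx
          simp only [Finset.mem_image, Finset.mem_Ico, Prod.mk.injEq] at hx
          obtain ⟨k, hk, rfl, rfl⟩ := hx
          simp only [primitiveShell, Finset.mem_filter, Finset.mem_product, Finset.mem_range,
            Nat.gcd_one_left, true_and]
          omega

/-- Lebesgue measure on one period. -/
noncomputable def periodMeasure : Measure ℝ := volume.restrict (Set.Ioc (-π) π)

instance : IsFiniteMeasure periodMeasure := by unfold periodMeasure; infer_instance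

lemma integral_exp_int_mul_I (k : ℤ) :
    ∫ t, Complex.exp (((k : ℝ) * t : ℝ) * Complex.I) ∂periodMeasure =
      if k = 0 then ((2 * π : ℝ) : ℂ) else 0 := by
  rw [periodMeasure, ← intervalIntegral.integral_of_le (by linarith [pi_pos])]
  split_ifs with h
  · subst h
    simp
    ring
  · have hk : (k : ℂ) * Complex.I ≠ 0 := by simp [h]
    have e : ∀ t : ℝ, Complex.exp (((k : ℝ) * t : ℝ) * Complex.I) =
        Complex.exp ((k : ℂ) * Complex.I * t) := fun t => by push_cast; ring_nf
    simp only [e]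
    rw [integral_exp_mul_complex hk, div_eq_zero_iff]
    left
    rw [sub_eq_zero, Complex.exp_eq_exp_iff_exists_int]
    exact ⟨k, by push_cast; ring⟩

lemma integral_exp_int_mul_I_prod (a b c : ℤ) :
    ∫ t : ℝ × ℝ × ℝ, Complex.exp (((a : ℝ) * t.1 + (b : ℝ) * t.2.1 + (c : ℝ) * t.2.2 : ℝ)
        * Complex.I) ∂(periodMeasure.prod (periodMeasure.prod periodMeasure)) =
      if a = 0 ∧ b = 0 ∧ c = 0 then (((2 * π) ^ 3 : ℝ) : ℂ) else 0 := by
  have e : ∀ t : ℝ × ℝ × ℝ, Complex.exp (((a : ℝ) * t.1 + (b : ℝ) * t.2.1 + (c : ℝ) * t.2.2 : ℝ)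
      * Complex.I) = Complex.exp (((a : ℝ) * t.1 : ℝ) * Complex.I) *
        (Complex.exp (((b : ℝ) * t.2.1 : ℝ) * Complex.I) *
          Complex.exp (((c : ℝ) * t.2.2 : ℝ) * Complex.I)) := by
    intro t
    rw [← Complex.exp_add, ← Complex.exp_add]
    push_cast; ring_nf
  simp only [e]
  rw [integral_prod_mul (fun x : ℝ => Complex.exp (((a : ℝ) * x : ℝ) * Complex.I))
      (fun y : ℝ × ℝ => Complex.exp (((b : ℝ) * y.1 : ℝ) * Complex.I) *
          Complex.exp (((c : ℝ) * y.2 : ℝ) * Complex.I)),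
    integral_prod_mul (fun x : ℝ => Complex.exp (((b : ℝ) * x : ℝ) * Complex.I))
      (fun x : ℝ => Complex.exp (((c : ℝ) * x : ℝ) * Complex.I)),
    integral_exp_int_mul_I, integral_exp_int_mul_I, integral_exp_int_mul_I]
  by_cases ha : a = 0 <;> by_cases hb : b = 0 <;> by_cases hc : c = 0 <;> simp [ha, hb, hc]
  ring

/-- A coefficient of a trigonometric polynomial is at most the mean of its modulus. -/
lemma sum_filter_le_integral_norm {J : Type*} (s : Finset J) (w : J → ℝ) (u : J → ℕ × ℕ × ℕ)
    (v : ℕ × ℕ × ℕ) :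
    (2 * π) ^ 3 * ∑ j ∈ s with u j = v, w j ≤
      ∫ t : ℝ × ℝ × ℝ, ‖∑ j ∈ s, (w j : ℂ) * Complex.exp
        (((u j).1 * t.1 + (u j).2.1 * t.2.1 + (u j).2.2 * t.2.2 : ℝ) * Complex.I)‖
        ∂(periodMeasure.prod (periodMeasure.prod periodMeasure)) := by
  set μ := periodMeasure.prod (periodMeasure.prod periodMeasure) with hμ
  have key : ∫ t : ℝ × ℝ × ℝ, (∑ j ∈ s, (w j : ℂ) * Complex.exp
        (((u j).1 * t.1 + (u j).2.1 * t.2.1 + (u j).2.2 * t.2.2 : ℝ) * Complex.I)) *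
        Complex.exp ((-(v.1 * t.1 + v.2.1 * t.2.1 + v.2.2 * t.2.2) : ℝ) * Complex.I) ∂μ =
      (((2 * π) ^ 3 * ∑ j ∈ s with u j = v, w j : ℝ) : ℂ) := by
    have e : ∀ t : ℝ × ℝ × ℝ, (∑ j ∈ s, (w j : ℂ) * Complex.exp
        (((u j).1 * t.1 + (u j).2.1 * t.2.1 + (u j).2.2 * t.2.2 : ℝ) * Complex.I)) *
        Complex.exp ((-(v.1 * t.1 + v.2.1 * t.2.1 + v.2.2 * t.2.2) : ℝ) * Complex.I) =
        ∑ j ∈ s, (w j : ℂ) * Complex.exp ((((((u j).1 : ℤ) - (v.1 : ℤ) : ℤ) : ℝ) * t.1 +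
          ((((u j).2.1 : ℤ) - (v.2.1 : ℤ) : ℤ) : ℝ) * t.2.1 +
          ((((u j).2.2 : ℤ) - (v.2.2 : ℤ) : ℤ) : ℝ) * t.2.2 : ℝ) * Complex.I) := by
      intro t
      rw [Finset.sum_mul]
      refine Finset.sum_congr rfl fun j _ => ?_
      rw [mul_assoc, ← Complex.exp_add]
      push_cast; ring_nf
    simp only [e]
    rw [integral_finsetSum]
    · simp only [integral_const_mul, hμ, integral_exp_int_mul_I_prod]
      rw [Finset.sum_filter, Finset.mul_sum, Complex.ofReal_sum]
      refine Finset.sum_congr rfl fun j _ => ?_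
      have : (((u j).1 : ℤ) - (v.1 : ℤ) = 0 ∧ ((u j).2.1 : ℤ) - (v.2.1 : ℤ) = 0 ∧
          ((u j).2.2 : ℤ) - (v.2.2 : ℤ) = 0) ↔ u j = v := by
        rw [Prod.ext_iff, Prod.ext_iff]; omega
      simp only [this]
      split_ifs
      · push_cast; ring
      · simp
    · intro j _
      refine Integrable.const_mul ?_ _
      refine Integrable.of_bound (C := 1) ?_ (Eventually.of_forall fun t => ?_)
      · exact (by fun_prop : Continuous _).aestronglyMeasurable
      · rw [Complex.norm_exp_ofReal_mul_I]
  have h := norm_integral_le_integral_norm (μ := μ) fun t : ℝ × ℝ × ℝ =>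
    (∑ j ∈ s, (w j : ℂ) * Complex.exp
        (((u j).1 * t.1 + (u j).2.1 * t.2.1 + (u j).2.2 * t.2.2 : ℝ) * Complex.I)) *
        Complex.exp ((-(v.1 * t.1 + v.2.1 * t.2.1 + v.2.2 * t.2.2) : ℝ) * Complex.I)
  rw [key, Complex.norm_real] at h
  refine (le_norm_self _).trans (h.trans (le_of_eq ?_))
  congr 1
  ext t
  rw [norm_mul, Complex.norm_exp_ofReal_mul_I, mul_one]

lemma add_ne_zero_of_gcd_eq_one {x : ℕ × ℕ} (hx : Nat.gcd x.1 x.2 = 1) : x.1 + x.2 ≠ 0 := by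
  intro h
  have h1 : x.1 = 0 := by omega
  have h2 : x.2 = 0 := by omega
  rw [h1, h2] at hx
  exact absurd hx (by norm_num)

/-- The primitive vectors of the square `[0, n]²`. -/
def primitiveSquare (n : ℕ) : Finset Xc :=
  (Finset.range (n + 1) ×ˢ Finset.range (n + 1)).subtype fun x => Nat.gcd x.1 x.2 = 1

lemma chain_mul_le {n : ℕ} {ν : Xc →₀ ℕ} (h : chainEndpoint ν = (n, n)) (x : Xc) :
    ν x * x.val.1 ≤ n ∧ ν x * x.val.2 ≤ n := by
  simp only [chainEndpoint, Prod.mk.injEq, Finsupp.sum] at h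
  by_cases hx : x ∈ ν.support
  · exact ⟨(Finset.single_le_sum (f := fun x : Xc => ν x * x.val.1) (fun _ _ => Nat.zero_le _)
      hx).trans h.1.le, (Finset.single_le_sum (f := fun x : Xc => ν x * x.val.2)
      (fun _ _ => Nat.zero_le _) hx).trans h.2.le⟩
  · rw [Finsupp.notMem_support_iff.mp hx]; simp

lemma chain_apply_le {n : ℕ} {ν : Xc →₀ ℕ} (h : chainEndpoint ν = (n, n)) (x : Xc) :
    ν x ≤ n := by
  obtain ⟨h1, h2⟩ := chain_mul_le h x
  have := add_ne_zero_of_gcd_eq_one x.2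
  rcases Nat.eq_zero_or_pos x.val.1 with h0 | h0
  · exact (Nat.le_mul_of_pos_right _ (by omega)).trans h2
  · exact (Nat.le_mul_of_pos_right _ h0).trans h1

lemma chain_support_subset {n : ℕ} {ν : Xc →₀ ℕ} (h : chainEndpoint ν = (n, n)) :
    ν.support ⊆ primitiveSquare n := by
  intro x hx
  obtain ⟨h1, h2⟩ := chain_mul_le h x
  have h0 : 0 < ν x := Nat.pos_of_ne_zero (Finsupp.mem_support_iff.mp hx)
  simp only [primitiveSquare, Finset.mem_subtype, Finset.mem_product, Finset.mem_range,
    Nat.lt_succ_iff]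
  exact ⟨(Nat.le_mul_of_pos_left _ h0).trans h1, (Nat.le_mul_of_pos_left _ h0).trans h2⟩

/-- The endpoint and number of vertices of the chain encoded by `g`. -/
def chainStat {T : Finset Xc} (g : T → ℕ) : ℕ × ℕ × ℕ :=
  (∑ i, g i * i.val.val.1, ∑ i, g i * i.val.val.2, ∑ i, if g i = 0 then 0 else 1)

lemma numChains_le_card (n N : ℕ) :
    numChains n n N ≤ ((Fintype.piFinset fun _ : primitiveSquare n => Finset.range (n + 1)).filter
      fun g => chainStat g = (n, n, N)).card := by
  set G := (Fintype.piFinset fun _ : primitiveSquare n => Finset.range (n + 1)).filter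
      fun g => chainStat g = (n, n, N) with hG
  have hmem : ∀ ν : {ν : Xc →₀ ℕ // chainEndpoint ν = (n, n) ∧ ν.support.card = N},
      (fun i : primitiveSquare n => ν.val i.val) ∈ G := by
    rintro ⟨ν, hν, hN⟩
    have hsub := chain_support_subset hν
    rw [hG, Finset.mem_filter, Fintype.mem_piFinset]
    refine ⟨fun i => Finset.mem_range.mpr (Nat.lt_succ_of_le (chain_apply_le hν i.val)), ?_⟩
    simp only [chainEndpoint, Prod.mk.injEq] at hν
    rw [Finsupp.sum_of_support_subset ν hsub _ (by simp),
      Finsupp.sum_of_support_subset ν hsub _ (by simp)] at hν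
    simp only [chainStat, Prod.mk.injEq]
    rw [Finset.sum_coe_sort (primitiveSquare n) fun x => ν x * x.val.1,
      Finset.sum_coe_sort (primitiveSquare n) fun x => ν x * x.val.2,
      Finset.sum_coe_sort (primitiveSquare n) fun x => if ν x = 0 then 0 else 1]
    refine ⟨hν.1, hν.2, ?_⟩
    rw [← hN, Finset.card_eq_sum_ones]
    refine (Finset.sum_subset_zero_on_sdiff hsub ?_ ?_).symm
    · intro x hx
      rw [Finset.mem_sdiff, Finsupp.notMem_support_iff] at hx
      simp [hx.2]
    · intro x hx
      simp [Finsupp.mem_support_iff.mp hx]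
  rw [← Fintype.card_coe G, ← Nat.card_eq_fintype_card]
  refine Nat.card_le_card_of_injective (fun ν => (⟨_, hmem ν⟩ : G)) fun ν ν' h => ?_
  have h' := Subtype.mk.inj h
  refine Subtype.ext (Finsupp.ext fun x => ?_)
  by_cases hx : x ∈ primitiveSquare n
  · exact congrFun h' ⟨x, hx⟩
  · rw [Finsupp.notMem_support_iff.mp fun h => hx (chain_support_subset ν.2.1 h),
      Finsupp.notMem_support_iff.mp fun h => hx (chain_support_subset ν'.2.1 h)]

lemma prod_edgeWeight {z l : ℝ} {T : Finset Xc} {n N : ℕ} {g : T → ℕ}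
    (hg : chainStat g = (n, n, N)) :
    ∏ i, edgeWeight z l (i.val.val.1 + i.val.val.2) (g i) = z ^ (2 * n) * l ^ N *
      ∏ x ∈ T, (1 - z ^ (x.val.1 + x.val.2)) / (1 + (l - 1) * z ^ (x.val.1 + x.val.2)) := by
  simp only [chainStat, Prod.mk.injEq] at hg
  have e : ∀ i : T, edgeWeight z l (i.val.val.1 + i.val.val.2) (g i) =
      (1 - z ^ (i.val.val.1 + i.val.val.2)) / (1 + (l - 1) * z ^ (i.val.val.1 + i.val.val.2)) *
      (l ^ (if g i = 0 then 0 else 1) * z ^ (g i * i.val.val.1 + g i * i.val.val.2)) := by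
    intro i
    unfold edgeWeight
    split_ifs with h
    · simp [h]
    · rw [pow_one]; ring_nf
  simp only [e, Finset.prod_mul_distrib, Finset.prod_pow_eq_pow_sum, Finset.sum_add_distrib,
    hg.1, hg.2.1, hg.2.2]
  rw [Finset.prod_coe_sort T fun x : Xc =>
    (1 - z ^ (x.val.1 + x.val.2)) / (1 + (l - 1) * z ^ (x.val.1 + x.val.2))]
  ring

lemma prod_edgeChar (z l : ℝ) (n : ℕ) (T : Finset Xc) (t : ℝ × ℝ × ℝ) :
    ∏ x ∈ T, edgeChar z l n x.val t =
      ∑ g ∈ Fintype.piFinset fun _ : T => Finset.range (n + 1),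
        ((∏ i, edgeWeight z l (i.val.val.1 + i.val.val.2) (g i) : ℝ) : ℂ) *
        Complex.exp (((chainStat g).1 * t.1 + (chainStat g).2.1 * t.2.1 +
          (chainStat g).2.2 * t.2.2 : ℝ) * Complex.I) := by
  rw [← Finset.prod_coe_sort T fun x : Xc => edgeChar z l n x.val t]
  simp only [edgeChar]
  rw [Finset.prod_univ_sum]
  refine Finset.sum_congr rfl fun g _ => ?_
  rw [Finset.prod_mul_distrib, ← Complex.exp_sum, ← Finset.sum_mul, ← Complex.ofReal_sum,
    Complex.ofReal_prod]
  congr 4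
  simp only [edgePhase, chainStat, Finset.sum_add_distrib, Nat.cast_sum, Nat.cast_mul,
    Nat.cast_ite, Nat.cast_zero, Nat.cast_one, Finset.sum_mul, mul_add, ite_mul, zero_mul, one_mul]
  congr 2 <;> exact Finset.sum_congr rfl fun i _ => by ring

lemma emptyWeight_mem_Icc {z l : ℝ} (hl : 0 < l) (hz0 : 0 < z) (hz1 : z < 1) {m : ℕ}
    (hm : m ≠ 0) : 0 ≤ (1 - z ^ m) / (1 + (l - 1) * z ^ m) ∧
      (1 - z ^ m) / (1 + (l - 1) * z ^ m) ≤ 1 := by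
  have h1 := pow_lt_one₀ hz0.le hz1 hm
  have hw := pow_pos hz0 m
  have h2 := one_add_sub_one_mul_pos hl hw.le h1
  refine ⟨div_nonneg (by linarith) h2.le, (div_le_one h2).mpr ?_⟩
  nlinarith [mul_pos hl hw]

lemma tprod_le_prod_of_mem_Icc {ι : Type*} {f : ι → ℝ} (h0 : ∀ i, 0 ≤ f i) (h1 : ∀ i, f i ≤ 1) :
    0 ≤ ∏' i, f i ∧ ∀ T : Finset ι, ∏' i, f i ≤ ∏ i ∈ T, f i := by
  have hanti : Antitone fun s : Finset ι => ∏ i ∈ s, f i :=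
    Finset.prod_anti_set_of_le_one h0 h1
  have hnn : ∀ s : Finset ι, 0 ≤ ∏ i ∈ s, f i := fun s => Finset.prod_nonneg fun i _ => h0 i
  have hbdd : BddBelow (Set.range fun s : Finset ι => ∏ i ∈ s, f i) :=
    ⟨0, by rintro _ ⟨s, rfl⟩; exact hnn s⟩
  have h : HasProd f (⨅ s : Finset ι, ∏ i ∈ s, f i) := tendsto_atTop_ciInf hanti hbdd
  rw [h.tprod_eq]
  exact ⟨le_ciInf hnn, ciInf_le hbdd⟩

lemma chain_probability_le {z l : ℝ} (hl : 0 < l) (hz0 : 0 < z) (hz1 : z < 1) (n N : ℕ) :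
    (2 * π) ^ 3 * ((numChains n n N : ℝ) * z ^ (2 * n) * l ^ N *
      ∏' x : Xc, (1 - z ^ (x.val.1 + x.val.2)) / (1 + (l - 1) * z ^ (x.val.1 + x.val.2))) ≤
    ∫ t : ℝ × ℝ × ℝ, ‖∏ x ∈ primitiveSquare n, edgeChar z l n x.val t‖
      ∂(periodMeasure.prod (periodMeasure.prod periodMeasure)) := by
  have hQ := fun x : Xc => emptyWeight_mem_Icc hl hz0 hz1 (add_ne_zero_of_gcd_eq_one x.2)
  simp only [prod_edgeChar]
  refine le_trans ?_ (sum_filter_le_integral_norm _ _ _ (n, n, N))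
  refine mul_le_mul_of_nonneg_left ?_ (by positivity)
  rw [Finset.sum_congr rfl fun g hg => prod_edgeWeight (Finset.mem_filter.mp hg).2,
    Finset.sum_const, nsmul_eq_mul, ← mul_assoc, ← mul_assoc]
  have h1 : (numChains n n N : ℝ) ≤ _ := Nat.cast_le.mpr (numChains_le_card n N)
  obtain ⟨h0, h2⟩ := tprod_le_prod_of_mem_Icc (fun x => (hQ x).1) (fun x => (hQ x).2)
  have h2 := h2 (primitiveSquare n)
  have h3 : 0 ≤ ∏ x ∈ primitiveSquare n,
      (1 - z ^ (x.val.1 + x.val.2)) / (1 + (l - 1) * z ^ (x.val.1 + x.val.2)) :=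
    Finset.prod_nonneg fun x _ => (hQ x).1
  gcongr

lemma norm_prod_edgeChar_le {z l : ℝ} (hl : 0 < l) (hz0 : 0 < z) (hz1 : z < 1) {n R : ℕ}
    (hR : 16 ≤ R) (hn : 4 * R ≤ n) {c : ℝ}
    (hc : ∀ m : ℕ, R ≤ 32 * m → m ≤ 4 * R →
      2 * c ≤ edgeWeight z l m 0 * edgeWeight z l m 1 ∧
      2 * c ≤ edgeWeight z l m 1 * edgeWeight z l m 2) (t : ℝ × ℝ × ℝ) :
    ‖∏ x ∈ primitiveSquare n, edgeChar z l n x.val t‖ ≤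
      exp (-(c * ∑ x ∈ primitiveShell R, ((1 - cos (t.1 * x.1 + t.2.1 * x.2 + t.2.2))
        + (1 - cos (t.1 * x.1 + t.2.1 * x.2))))) := by
  rw [primitiveSquare, Finset.prod_subtype_eq_prod_filter (fun x => edgeChar z l n x t), norm_prod]
  have hsub : primitiveShell R ⊆ (Finset.range (n + 1) ×ˢ Finset.range (n + 1)).filter
      fun x => Nat.gcd x.1 x.2 = 1 := by
    intro x hx
    simp only [primitiveShell, Finset.mem_filter, Finset.mem_product, Finset.mem_range] at hx ⊢
    exact ⟨⟨by omega, by omega⟩, hx.2.1⟩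
  refine (Finset.prod_le_prod_of_subset_of_le_one hsub (fun _ _ => norm_nonneg _)
    fun x hx _ => norm_edgeChar_le_one hl hz0 hz1 n
      (add_ne_zero_of_gcd_eq_one (Finset.mem_filter.mp hx).2) t).trans ?_
  rw [Finset.mul_sum, ← Finset.sum_neg_distrib, exp_sum]
  refine Finset.prod_le_prod (fun _ _ => norm_nonneg _) fun x hx => ?_
  obtain ⟨hx1, hx2, hx3⟩ := (Finset.mem_filter.mp hx).2
  obtain ⟨h1, h2⟩ := hc _ hx2 hx3
  exact norm_edgeChar_le_exp hl hz0 hz1 (by omega) (add_ne_zero_of_gcd_eq_one hx1) h1 h2 t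

lemma exp_sum_one_sub_cos_le (R : ℕ) (hR : 16 ≤ R) {k : ℝ} (hk : 0 ≤ k) {a b s : ℝ}
    (ha : |a| ≤ π) (hb : |b| ≤ π) (hs : |s| ≤ π) :
    exp (-(327680 * k * ∑ x ∈ primitiveShell R, ((1 - cos (a * x.1 + b * x.2 + s))
        + (1 - cos (a * x.1 + b * x.2))))) ≤
      exp (-(k * R ^ 4) * a ^ 2) * (exp (-(k * R ^ 4) * b ^ 2) * exp (-(k * R ^ 2) * s ^ 2)) +
        exp (-(k * R)) * exp (-(k * R ^ 2) * s ^ 2) := by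
  set D := ∑ x ∈ primitiveShell R, (1 - cos (a * x.1 + b * x.2)) with hD
  set E := ∑ x ∈ primitiveShell R, ((1 - cos (a * x.1 + b * x.2 + s))
        + (1 - cos (a * x.1 + b * x.2))) with hE
  have hDE : D ≤ E := Finset.sum_le_sum fun x _ => by linarith [cos_le_one (a * x.1 + b * x.2 + s)]
  have hcard := card_primitiveShell R hR
  have hsE : (R : ℝ) ^ 2 * s ^ 2 / 160 ≤ E := by
    calc (R : ℝ) ^ 2 * s ^ 2 / 160 = (R : ℝ) ^ 2 / 16 * (s ^ 2 / 5 / 2) := by ring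
      _ ≤ (primitiveShell R).card * ((1 - cos s) / 2) := by
          have := sq_div_five_le_one_sub_cos hs
          gcongr
      _ = ∑ x ∈ primitiveShell R, (1 - cos s) / 2 := by simp
      _ ≤ E := Finset.sum_le_sum fun x _ => by
          have := one_sub_cos_sub_le (a * x.1 + b * x.2 + s) (a * x.1 + b * x.2)
          rw [add_sub_cancel_left] at this
          linarith
  rw [← exp_add, ← exp_add, ← exp_add]
  have hss : 0 ≤ (R : ℝ) ^ 2 * s ^ 2 := by positivity
  by_cases hnear : |a| * R ≤ 1 ∧ |b| * R ≤ 1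
  · have h := near_le_sum_one_sub_cos R hR a b hnear.1 hnear.2
    have h1 : (R : ℝ) ^ 4 * a ^ 2 + R ^ 4 * b ^ 2 + R ^ 2 * s ^ 2 ≤ 327680 * E := by linarith
    refine le_add_of_le_of_nonneg (exp_le_exp.mpr ?_) (exp_pos _).le
    nlinarith [mul_le_mul_of_nonneg_left h1 hk]
  · have h := far_le_sum_one_sub_cos R hR a b ha hb (by
      rw [not_and_or, not_le, not_le] at hnear
      exact hnear.imp le_of_lt le_of_lt)
    have h1 : (R : ℝ) + R ^ 2 * s ^ 2 ≤ 327680 * E := by linarith [Nat.cast_nonneg (α := ℝ) R]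
    refine le_add_of_nonneg_of_le (exp_pos _).le (exp_le_exp.mpr ?_)
    nlinarith [mul_le_mul_of_nonneg_left h1 hk]

lemma integral_exp_neg_mul_sq_le {b : ℝ} (hb : 0 < b) :
    ∫ x, exp (-b * x ^ 2) ∂periodMeasure ≤ √(π / b) := by
  rw [← integral_gaussian b]
  exact setIntegral_le_integral (integrable_exp_neg_mul_sq hb)
    (Eventually.of_forall fun x => (exp_pos _).le)

lemma integral_gaussian_prod_le {p q e : ℝ} (hp : 0 < p) (hq : 0 < q) (he : 0 ≤ e) :
    Integrable (fun t : ℝ × ℝ × ℝ => exp (-p * t.1 ^ 2) * (exp (-p * t.2.1 ^ 2) *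
        exp (-q * t.2.2 ^ 2)) + e * exp (-q * t.2.2 ^ 2))
        (periodMeasure.prod (periodMeasure.prod periodMeasure)) ∧
    ∫ t : ℝ × ℝ × ℝ, exp (-p * t.1 ^ 2) * (exp (-p * t.2.1 ^ 2) *
        exp (-q * t.2.2 ^ 2)) + e * exp (-q * t.2.2 ^ 2)
        ∂(periodMeasure.prod (periodMeasure.prod periodMeasure)) ≤
      √(π / q) * (π / p + (2 * π) ^ 2 * e) := by
  have hmass : periodMeasure.real Set.univ = 2 * π := by
    rw [periodMeasure, measureReal_restrict_apply_univ, Real.volume_real_Ioc_of_le (by linarith [pi_pos])]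
    ring
  have hg : ∀ b : ℝ, 0 < b → ∀ x : ℝ, ‖exp (-b * x ^ 2)‖ ≤ 1 := fun b hb x => by
    rw [norm_of_nonneg (exp_pos _).le, exp_le_one_iff]
    nlinarith [mul_nonneg hb.le (sq_nonneg x)]
  have i1 : ∀ b : ℝ, 0 < b → Integrable (fun x : ℝ => exp (-b * x ^ 2)) periodMeasure :=
    fun b hb => Integrable.of_bound (by fun_prop) 1 (Eventually.of_forall (hg b hb))
  have j1 := (i1 p hp).mul_prod ((i1 p hp).mul_prod (i1 q hq))
  have j2 := ((integrable_const (μ := periodMeasure) (1 : ℝ)).mul_prod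
    ((integrable_const (μ := periodMeasure) (1 : ℝ)).mul_prod (i1 q hq))).const_mul e
  simp only [one_mul] at j2
  refine ⟨j1.add j2, ?_⟩
  rw [integral_add j1 j2, integral_const_mul,
    integral_prod_mul (fun x : ℝ => exp (-p * x ^ 2))
      (fun y : ℝ × ℝ => exp (-p * y.1 ^ 2) * exp (-q * y.2 ^ 2)),
    integral_prod_mul (fun x : ℝ => exp (-p * x ^ 2)) (fun x : ℝ => exp (-q * x ^ 2))]
  have j3 : ∫ t : ℝ × ℝ × ℝ, exp (-q * t.2.2 ^ 2)
      ∂(periodMeasure.prod (periodMeasure.prod periodMeasure)) =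
      (2 * π) * ((2 * π) * ∫ x, exp (-q * x ^ 2) ∂periodMeasure) := by
    have h1 := integral_prod_mul (μ := periodMeasure) (ν := periodMeasure.prod periodMeasure)
      (fun _ : ℝ => (1 : ℝ)) (fun y : ℝ × ℝ => exp (-q * y.2 ^ 2))
    have h2 := integral_prod_mul (μ := periodMeasure) (ν := periodMeasure)
      (fun _ : ℝ => (1 : ℝ)) (fun x : ℝ => exp (-q * x ^ 2))
    simp only [one_mul, integral_const, hmass, smul_eq_mul, mul_one] at h1 h2
    rw [h1, h2]
  rw [j3]
  have b1 := integral_exp_neg_mul_sq_le hp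
  have b2 := integral_exp_neg_mul_sq_le hq
  have n1 : 0 ≤ ∫ x, exp (-p * x ^ 2) ∂periodMeasure := integral_nonneg fun x => (exp_pos _).le
  have n2 : 0 ≤ ∫ x, exp (-q * x ^ 2) ∂periodMeasure := integral_nonneg fun x => (exp_pos _).le
  calc _ ≤ √(π / p) * (√(π / p) * √(π / q)) + e * (2 * π * (2 * π * √(π / q))) := by
        have := pi_pos
        gcongr
    _ = √(π / q) * ((√(π / p)) ^ 2 + (2 * π) ^ 2 * e) := by ring
    _ = _ := by rw [sq_sqrt (by positivity)]

lemma integral_norm_prod_edgeChar_le {z l : ℝ} (hl : 0 < l) (hz0 : 0 < z) (hz1 : z < 1)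
    {n R : ℕ} (hR : 16 ≤ R) (hn : 4 * R ≤ n) {k : ℝ} (hk : 0 < k)
    (hc : ∀ m : ℕ, R ≤ 32 * m → m ≤ 4 * R →
      2 * (327680 * k) ≤ edgeWeight z l m 0 * edgeWeight z l m 1 ∧
      2 * (327680 * k) ≤ edgeWeight z l m 1 * edgeWeight z l m 2) :
    ∫ t : ℝ × ℝ × ℝ, ‖∏ x ∈ primitiveSquare n, edgeChar z l n x.val t‖
      ∂(periodMeasure.prod (periodMeasure.prod periodMeasure)) ≤
      √(π / k) * (π / k + (2 * π) ^ 2 * (24 / k ^ 4)) / R ^ 5 := by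
  have hR0 : (0 : ℝ) < R := by exact_mod_cast (by omega : 0 < R)
  obtain ⟨hint, hle⟩ := integral_gaussian_prod_le (p := k * R ^ 4) (q := k * R ^ 2)
    (e := exp (-(k * R))) (by positivity) (by positivity) (exp_pos _).le
  have hae : ∀ᵐ t ∂(periodMeasure.prod (periodMeasure.prod periodMeasure)),
      |t.1| ≤ π ∧ |t.2.1| ≤ π ∧ |t.2.2| ≤ π := by
    have h1 : ∀ᵐ x ∂periodMeasure, |x| ≤ π := by
      refine (ae_restrict_mem measurableSet_Ioc).mono fun x hx => ?_
      exact abs_le.mpr ⟨hx.1.le, hx.2⟩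
    have h2 := Measure.quasiMeasurePreserving_fst (μ := periodMeasure)
      (ν := periodMeasure.prod periodMeasure) |>.ae h1
    have h3 := Measure.quasiMeasurePreserving_snd (μ := periodMeasure)
      (ν := periodMeasure.prod periodMeasure) |>.ae
        (Measure.quasiMeasurePreserving_fst (μ := periodMeasure) (ν := periodMeasure) |>.ae h1)
    have h4 := Measure.quasiMeasurePreserving_snd (μ := periodMeasure)
      (ν := periodMeasure.prod periodMeasure) |>.ae
        (Measure.quasiMeasurePreserving_snd (μ := periodMeasure) (ν := periodMeasure) |>.ae h1)
    filter_upwards [h2, h3, h4] with t a b c using ⟨a, b, c⟩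
  refine (integral_mono_of_nonneg (Eventually.of_forall fun t => norm_nonneg _) hint
    (hae.mono fun t ht => (norm_prod_edgeChar_le hl hz0 hz1 hR hn hc t).trans
      (exp_sum_one_sub_cos_le R hR hk.le ht.1 ht.2.1 ht.2.2))).trans (hle.trans ?_)
  have hexp : exp (-(k * R)) ≤ 24 / k ^ 4 / R ^ 4 := by
    have h := pow_div_factorial_le_exp (x := k * R) (by positivity) 4
    have h24 : ((Nat.factorial 4 : ℕ) : ℝ) = 24 := by norm_num [Nat.factorial]
    rw [h24] at h
    rw [exp_neg, div_div, ← mul_pow, ← inv_div]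
    exact inv_anti₀ (by positivity) h
  have hsqrt : √(π / (k * R ^ 2)) = √(π / k) / R := by
    rw [← div_div, sqrt_div (by positivity), sqrt_sq hR0.le]
  rw [hsqrt]
  calc √(π / k) / R * (π / (k * R ^ 4) + (2 * π) ^ 2 * exp (-(k * R)))
      ≤ √(π / k) / R * (π / (k * R ^ 4) + (2 * π) ^ 2 * (24 / k ^ 4 / R ^ 4)) := by gcongr
    _ = _ := by field_simp

lemma edgeWeight_mul_lower {z l a b : ℝ} (hl : 0 < l) (ha : 0 < a) (hb : b < 1) {m : ℕ}
    (h1 : a ≤ z ^ m) (h2 : z ^ m ≤ b) :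
    ((1 - b) / (1 + l)) ^ 2 * (l * a) ≤ edgeWeight z l m 0 * edgeWeight z l m 1 ∧
    ((1 - b) / (1 + l)) ^ 2 * (l ^ 2 * a ^ 3) ≤ edgeWeight z l m 1 * edgeWeight z l m 2 := by
  simp only [edgeWeight, if_true, one_ne_zero, two_ne_zero, if_false, mul_one, pow_mul]
  set w := z ^ m
  have hw : 0 < w := ha.trans_le h1
  have hD := one_add_sub_one_mul_pos hl hw.le (h2.trans_lt hb)
  have hq : (1 - b) / (1 + l) ≤ (1 - w) / (1 + (l - 1) * w) := by
    have : 0 ≤ 1 - w := by linarith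
    gcongr
    nlinarith
  have hq0 : 0 ≤ (1 - b) / (1 + l) := div_nonneg (by linarith) (by linarith)
  set q := (1 - w) / (1 + (l - 1) * w)
  constructor
  · calc ((1 - b) / (1 + l)) ^ 2 * (l * a) ≤ q ^ 2 * (l * w) := by gcongr
      _ = _ := by ring
  · calc ((1 - b) / (1 + l)) ^ 2 * (l ^ 2 * a ^ 3) ≤ q ^ 2 * (l ^ 2 * w ^ 3) := by gcongr
      _ = _ := by ring

lemma pow_mem_Icc_of_scale {d y : ℝ} (hd : 0 < d) (hy1 : 1 ≤ y) (hy : 2 * d ≤ y) {m R : ℕ}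
    (hRy : (R : ℝ) ≤ y) (hyR : y ≤ 2 * R) (h1 : R ≤ 32 * m) (h2 : m ≤ 4 * R) :
    exp (-(8 * d)) ≤ (1 - d * y⁻¹) ^ m ∧ (1 - d * y⁻¹) ^ m ≤ exp (-(d / 64)) := by
  have hy0 : 0 < y := by linarith
  have he0 : 0 < d * y⁻¹ := by positivity
  have he : d * y⁻¹ ≤ 1 / 2 := by
    rw [← div_eq_mul_inv, div_le_iff₀ hy0]; linarith
  have h1' : (R : ℝ) ≤ 32 * m := by exact_mod_cast h1
  have h2' : (m : ℝ) ≤ 4 * R := by exact_mod_cast h2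
  have hyy : y⁻¹ * y = 1 := inv_mul_cancel₀ hy0.ne'
  constructor
  · have hlow : exp (-(2 * (d * y⁻¹))) ≤ 1 - d * y⁻¹ := by
      rw [exp_neg]
      have h3 := add_one_le_exp (2 * (d * y⁻¹))
      refine (inv_anti₀ (by linarith) h3).trans ?_
      rw [inv_le_iff_one_le_mul₀ (by linarith)]
      nlinarith
    calc exp (-(8 * d)) ≤ exp (m * -(2 * (d * y⁻¹))) := by
          apply exp_le_exp.mpr
          have : d * y⁻¹ * m ≤ d * y⁻¹ * (4 * y) := by gcongr; linarith
          nlinarith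
      _ = exp (-(2 * (d * y⁻¹))) ^ m := exp_nat_mul _ _
      _ ≤ _ := by gcongr
  · calc (1 - d * y⁻¹) ^ m ≤ exp (-(d * y⁻¹)) ^ m := by
          gcongr
          · linarith
          · linarith [add_one_le_exp (-(d * y⁻¹))]
      _ = exp (m * -(d * y⁻¹)) := (exp_nat_mul _ _).symm
      _ ≤ _ := by
          apply exp_le_exp.mpr
          have : d * y⁻¹ * (y / 64) ≤ d * y⁻¹ * m := by gcongr; linarith
          nlinarith

lemma zeta2_pos : 0 < zeta2 := by unfold zeta2; positivity

lemma deltafun_nonneg {l : ℝ} (hl : 0 < l) : 0 ≤ deltafun l := by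
  refine rpow_nonneg (div_nonneg (setIntegral_nonneg (measurableSet_Ioi.prod measurableSet_Ioi)
    fun t ht => ?_) zeta2_pos.le) _
  have h1 : (0 : ℝ) < t.1 := ht.1
  have h2 : (0 : ℝ) < t.2 := ht.2
  have h3 : exp (-(t.1 + t.2)) < 1 := exp_lt_one_iff.mpr (by linarith)
  have h4 := one_add_sub_one_mul_pos hl (exp_pos (-(t.1 + t.2))).le h3
  have h5 : 0 < 1 - exp (-(t.1 + t.2)) := by linarith
  positivity

lemma tprod_zero_of_one (l : ℝ) :
    ∏' x : Xc, (1 - (1 : ℝ) ^ (x.val.1 + x.val.2)) / (1 + (l - 1) * 1 ^ (x.val.1 + x.val.2)) = 0 := by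
  simp only [one_pow, sub_self, zero_div]
  refine HasProd.tprod_eq ?_
  exact hasProd_zero_of_exists_eq_zero ⟨⟨(1, 0), rfl⟩, rfl⟩

/-- The probability `Q_{z_n,z_n,λ}(Π(n,n,⌊c(λ)n^{2/3}⌋))` is `O(n^{−5/3})`:
`𝒩(n,n,⌊c(λ)n^{2/3}⌋)·z_n^{2n}·λ^{⌊c(λ)n^{2/3}⌋}·∏_{x∈X} (1−z_n^{x₁+x₂})/(1+(λ−1)z_n^{x₁+x₂})
= O(n^{−5/3})`. -/
theorem statement4 (l : ℝ) (hl : 0 < l) :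
    (fun n : ℕ =>
        (numChains n n ⌊cfun l * (n : ℝ) ^ ((2:ℝ)/3)⌋₊ : ℝ)
          * zseq l n ^ (2 * n)
          * l ^ ⌊cfun l * (n : ℝ) ^ ((2:ℝ)/3)⌋₊
          * ∏' x : Xc,
              (1 - zseq l n ^ (x.val.1 + x.val.2))
                / (1 + (l - 1) * zseq l n ^ (x.val.1 + x.val.2)))
      =O[atTop] (fun n : ℕ => (n : ℝ) ^ (-(5:ℝ)/3)) := by
  rcases (deltafun_nonneg hl).eq_or_lt with hd | hd
  · have hz : ∀ n, zseq l n = 1 := fun n => by simp [zseq, ← hd]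
    simp only [hz, tprod_zero_of_one, mul_zero]
    exact isBigO_zero _ _
  set d := deltafun l
  set a := exp (-(8 * d))
  set b := exp (-(d / 64))
  have ha0 : 0 < a := exp_pos _
  have hb1 : b < 1 := exp_lt_one_iff.mpr (by linarith)
  obtain ⟨k, hk, hk1, hk2⟩ : ∃ k : ℝ, 0 < k ∧
      2 * (327680 * k) ≤ ((1 - b) / (1 + l)) ^ 2 * (l * a) ∧
      2 * (327680 * k) ≤ ((1 - b) / (1 + l)) ^ 2 * (l ^ 2 * a ^ 3) := by
    have hb0 : 0 < (1 - b) / (1 + l) := div_pos (by linarith) (by linarith)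
    refine ⟨min (((1 - b) / (1 + l)) ^ 2 * (l * a)) (((1 - b) / (1 + l)) ^ 2 * (l ^ 2 * a ^ 3))
      / 655360, by positivity, ?_, ?_⟩
    · linarith [min_le_left (((1 - b) / (1 + l)) ^ 2 * (l * a))
        (((1 - b) / (1 + l)) ^ 2 * (l ^ 2 * a ^ 3))]
    · linarith [min_le_right (((1 - b) / (1 + l)) ^ 2 * (l * a))
        (((1 - b) / (1 + l)) ^ 2 * (l ^ 2 * a ^ 3))]
  set C := √(π / k) * (π / k + (2 * π) ^ 2 * (24 / k ^ 4))
  have hC0 : 0 ≤ C := by positivity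
  have hlim : Tendsto (fun n : ℕ => (n : ℝ) ^ ((1 : ℝ) / 3)) atTop atTop :=
    (tendsto_rpow_atTop (by norm_num)).comp tendsto_natCast_atTop_atTop
  refine IsBigO.of_bound (C * 32) ?_
  filter_upwards [hlim.eventually_ge_atTop 17, hlim.eventually_ge_atTop (2 * d),
    hlim.eventually_gt_atTop d] with n hy17 hy2 hyd
  set y := (n : ℝ) ^ ((1 : ℝ) / 3) with hy
  have hy0 : 0 < y := by linarith
  have hn0 : (0 : ℝ) ≤ n := Nat.cast_nonneg n
  have hy3 : y ^ 3 = n := by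
    rw [hy, ← rpow_natCast, ← rpow_mul hn0]; norm_num
  have hz : zseq l n = 1 - d * y⁻¹ := by
    rw [zseq, hy, ← rpow_neg hn0, neg_div]
  have hn5 : (n : ℝ) ^ (-(5 : ℝ) / 3) = (y ^ 5)⁻¹ := by
    rw [hy, ← rpow_natCast, ← rpow_mul hn0, ← rpow_neg hn0]; norm_num
  set R := ⌊y⌋₊
  have hRy : (R : ℝ) ≤ y := Nat.floor_le hy0.le
  have hyR1 : y < R + 1 := Nat.lt_floor_add_one y
  have hyR : y ≤ 2 * R := by linarith
  have hR16 : 16 ≤ R := Nat.le_floor (by push_cast; linarith)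
  have hRn : 4 * R ≤ n := by
    have : 4 * (R : ℝ) ≤ n := by rw [← hy3]; nlinarith [mul_pos hy0 hy0]
    exact_mod_cast this
  have hzd : d * y⁻¹ < 1 := by rwa [← div_eq_mul_inv, div_lt_one hy0]
  have hz0 : 0 < zseq l n := by rw [hz]; linarith
  have hz1 : zseq l n < 1 := by rw [hz]; linarith [mul_pos hd (inv_pos.mpr hy0)]
  have hmain := (chain_probability_le hl hz0 hz1 n ⌊cfun l * (n : ℝ) ^ ((2:ℝ)/3)⌋₊).trans
    (integral_norm_prod_edgeChar_le hl hz0 hz1 hR16 hRn hk fun m h1 h2 => by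
      obtain ⟨e1, e2⟩ := pow_mem_Icc_of_scale hd (by linarith) hy2 hRy hyR h1 h2
      rw [← hz] at e1 e2
      obtain ⟨f1, f2⟩ := edgeWeight_mul_lower hl ha0 hb1 e1 e2
      exact ⟨hk1.trans f1, hk2.trans f2⟩)
  have hnn := (tprod_le_prod_of_mem_Icc
    (fun x : Xc => (emptyWeight_mem_Icc hl hz0 hz1 (add_ne_zero_of_gcd_eq_one x.2)).1)
    (fun x => (emptyWeight_mem_Icc hl hz0 hz1 (add_ne_zero_of_gcd_eq_one x.2)).2)).1
  set Q := (numChains n n ⌊cfun l * (n : ℝ) ^ ((2:ℝ)/3)⌋₊ : ℝ) * zseq l n ^ (2 * n)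
    * l ^ ⌊cfun l * (n : ℝ) ^ ((2:ℝ)/3)⌋₊ * ∏' x : Xc, (1 - zseq l n ^ (x.val.1 + x.val.2))
      / (1 + (l - 1) * zseq l n ^ (x.val.1 + x.val.2))
  have hQ0 : 0 ≤ Q := by
    have := hz0.le
    exact mul_nonneg (by positivity) hnn
  rw [hn5, norm_of_nonneg hQ0, norm_of_nonneg (by positivity)]
  have hpi : 1 ≤ (2 * π) ^ 3 := one_le_pow₀ (by linarith [pi_gt_three])
  calc Q ≤ (2 * π) ^ 3 * Q := le_mul_of_one_le_left hQ0 hpi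
    _ ≤ C / R ^ 5 := hmain
    _ ≤ C / (y / 2) ^ 5 := by gcongr; linarith
    _ = C * 32 * (y ^ 5)⁻¹ := by field_simp; norm_num
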